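/- arXiv:2203.03383 — 2 statements merged into one kernel-verified Lean document; each statement's English description precedes it below -/
import Mathlib

section
/- Let n ≥ 1 and let F be an arbitrary subset of ℝ^n. If z and z' are both max-min fair in F, then z = z'. (Uniqueness of the max-min fair allocation.) -/
/-- A vector `z` is max-min fair in `F ⊆ ℝ^n` if `z ∈ F` and for every `z' ∈ F` and
every index `i` with `z'_i > z_i` there exists an index `j` with `z_j ≤ z_i` and
`z'_j < z_j`. -/
def MaxMinFair {n : ℕ} (F : Set (Fin n → ℝ)) (z : Fin n → ℝ) : Prop :=
  z ∈ F ∧ ∀ z' ∈ F, ∀ i : Fin n, z i < z' i → ∃ j : Fin n, z j ≤ z i ∧ z' j < z j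

/-- Uniqueness of the max-min fair allocation: if `z` and `z'` are both max-min fair
in an arbitrary `F ⊆ ℝ^n`, then `z = z'`. -/
theorem maxMinFair_unique {n : ℕ} (hn : 1 ≤ n) (F : Set (Fin n → ℝ))
    (z z' : Fin n → ℝ) (hz : MaxMinFair F z) (hz' : MaxMinFair F z') :
    z = z' := by
  by_contra hne
  obtain ⟨k, hk⟩ := Function.ne_iff.mp hne
  obtain ⟨i, hi, hmin⟩ := Set.exists_min_image {i : Fin n | z i ≠ z' i}
    (fun i => min (z i) (z' i)) (Set.toFinite _) ⟨k, hk⟩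
  rcases lt_or_gt_of_ne hi with h | h
  · obtain ⟨j, h1, h2⟩ := hz.2 z' hz'.1 i h
    have h3 := hmin j (ne_of_gt h2)
    simp only [min_eq_left h.le, min_eq_right h2.le] at h3
    linarith
  · obtain ⟨j, h1, h2⟩ := hz'.2 z hz.1 i h
    have h3 := hmin j (ne_of_lt h2)
    simp only [min_eq_right h.le, min_eq_left h2.le] at h3
    linarith
end

section
/- Let m ≥ 1, n ≥ 1, let A be an m × n real matrix with all entries nonnegative, and let c ∈ ℝ^m have all entries nonnegative. Let F = { z ∈ ℝ^n : 0 ≤ z_i ≤ 1 for all i, and (A z)_j ≤ c_j for all j }. Then there exists a vector z that is max-min fair in F. (Existence of a max-min fair allocation for the admission-rate polytope with linear capacity constraints.) -/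
open Filter Topology in
/-- One water-filling step on a compact convex set. -/
theorem maxMin_step {n : ℕ} (F : Set (Fin n → ℝ)) (hF : IsCompact F) (hconv : Convex ℝ F)
    (S : Finset (Fin n)) (z : Fin n → ℝ) (hz : z ∈ F)
    (hord : ∀ i ∈ S, ∀ k, k ∉ S → z i ≤ z k)
    (hfair : ∀ i ∈ S, ∀ z' ∈ F, z i < z' i → ∃ j ∈ S, z j ≤ z i ∧ z' j < z j)
    (hS : Sᶜ.Nonempty) :
    ∃ (T : Finset (Fin n)) (w : Fin n → ℝ), S.card < T.card ∧ w ∈ F ∧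
      (∀ i ∈ T, ∀ k, k ∉ T → w i ≤ w k) ∧
      (∀ i ∈ T, ∀ z' ∈ F, w i < z' i → ∃ j ∈ T, w j ≤ w i ∧ z' j < w j) := by
  classical
  let G : Set (Fin n → ℝ) := F ∩ {w | ∀ i ∈ S, w i = z i}
  have hG : IsCompact G := by
    apply hF.inter_right
    simp only [Set.ofPred_forall]
    exact isClosed_iInter fun i => isClosed_iInter fun _ =>
      isClosed_eq (continuous_apply i) continuous_const
  let f : (Fin n → ℝ) → ℝ := fun w => Sᶜ.inf' hS (fun i => w i)
  have hf : Continuous f :=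
    Continuous.finset_inf'_apply hS (fun i _ => continuous_apply i)
  obtain ⟨u, huG, humax⟩ := hG.exists_isMaxOn ⟨z, hz, fun _ _ => rfl⟩ hf.continuousOn
  set t := f u with ht
  have hfle : ∀ w ∈ G, f w ≤ t := fun w hw => humax hw
  let E : (Fin n → ℝ) → Finset (Fin n) := fun w => Sᶜ.filter (fun i => w i = t)
  let H : Set (Fin n → ℝ) := {w | w ∈ G ∧ ∀ i, i ∉ S → t ≤ w i}
  have huH : u ∈ H := ⟨huG, fun i hi => Finset.inf'_le _ (Finset.mem_compl.2 hi)⟩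
  obtain ⟨w, hwH, hwmin⟩ : ∃ w ∈ H, ∀ v ∈ H, (E w).card ≤ (E v).card := by
    obtain ⟨w, hw, h⟩ := (measure fun w => (E w).card).wf.has_min H ⟨u, huH⟩
    exact ⟨w, hw, fun v hv => not_lt.1 (h v hv)⟩
  have hwF : w ∈ F := hwH.1.1
  have hwz : ∀ i ∈ S, w i = z i := hwH.1.2
  have hwt : ∀ i, i ∉ S → t ≤ w i := hwH.2
  have hzt : ∀ i ∈ S, z i ≤ t := fun i hi =>
    (Finset.le_inf' hS _ fun k hk => hord i hi k (Finset.mem_compl.1 hk)).trans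
      (hfle z ⟨hz, fun _ _ => rfl⟩)
  have memE : ∀ i, i ∈ E w ↔ i ∉ S ∧ w i = t := by intro i; simp [E]
  have hTle : ∀ i ∈ S ∪ E w, w i ≤ t := by
    intro i hi
    rcases Finset.mem_union.1 hi with h | h
    · rw [hwz i h]; exact hzt i h
    · exact ((memE i).1 h).2.le
  have hTlt : ∀ k, k ∉ S ∪ E w → t < w k := by
    intro k hk
    rw [Finset.mem_union, memE] at hk
    push Not at hk
    exact lt_of_le_of_ne (hwt k hk.1) (Ne.symm (hk.2 hk.1))
  refine ⟨S ∪ E w, w, ?_, hwF, fun i hi k hk => (hTle i hi).trans (hTlt k hk).le, ?_⟩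
  · obtain ⟨b, hb, hbe⟩ := Finset.exists_mem_eq_inf' hS (fun i => w i)
    have hbS := Finset.mem_compl.1 hb
    have hbt : w b = t := le_antisymm (by rw [← hbe]; exact hfle w hwH.1) (hwt b hbS)
    apply Finset.card_lt_card
    refine ⟨Finset.subset_union_left, fun h => hbS (h ?_)⟩
    exact Finset.mem_union_right _ ((memE b).2 ⟨hbS, hbt⟩)
  · intro i hi z' hz' hlt
    rcases Finset.mem_union.1 hi with hiS | hiE
    · rw [hwz i hiS] at hlt
      obtain ⟨j, hj, h1, h2⟩ := hfair i hiS z' hz' hlt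
      exact ⟨j, Finset.mem_union_left _ hj, by rw [hwz i hiS, hwz j hj]; exact h1,
        by rw [hwz j hj]; exact h2⟩
    · by_contra hcon
      push Not at hcon
      have hit := ((memE i).1 hiE).2
      have hge : ∀ j ∈ S ∪ E w, w j ≤ z' j := fun j hj =>
        hcon j hj (by rw [hit]; exact hTle j hj)
      have heq : ∀ j ∈ S, z' j = z j := by
        intro j hj
        have h0 := hge j (Finset.mem_union_left _ hj)
        rw [hwz j hj] at h0
        refine le_antisymm (not_lt.1 fun h => ?_) h0
        obtain ⟨k, hk, _, h2⟩ := hfair j hj z' hz' h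
        have := hge k (Finset.mem_union_left _ hk)
        rw [hwz k hk] at this
        linarith
      have hev : ∀ᶠ e in 𝓝[>] (0:ℝ), ∀ k, k ∉ S ∪ E w → t < w k + e * (z' k - w k) := by
        rw [Filter.eventually_all]
        intro k
        by_cases hk : k ∈ S ∪ E w
        · exact Filter.Eventually.of_forall fun e h => absurd hk h
        · have hc : ContinuousAt (fun e : ℝ => w k + e * (z' k - w k)) 0 := by fun_prop
          have h0 : t < w k + 0 * (z' k - w k) := by simpa using hTlt k hk
          filter_upwards [nhdsWithin_le_nhds (hc.eventually (lt_mem_nhds h0))] with e he _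
          exact he
      have hI : ∀ᶠ e in 𝓝[>] (0:ℝ), e ∈ Set.Ioo (0:ℝ) 1 := Ioo_mem_nhdsGT one_pos
      obtain ⟨e, he, he0, he1⟩ := (hev.and hI).exists
      let v : Fin n → ℝ := fun k => w k + e * (z' k - w k)
      have hvF : v ∈ F := by
        have := hconv hwF hz' (sub_nonneg.2 he1.le) he0.le (by ring : (1 - e) + e = 1)
        convert this using 1
        ext k
        simp [v]; ring
      have hvH : v ∈ H := by
        refine ⟨⟨hvF, fun j hj => ?_⟩, fun k hk => ?_⟩
        · simp [v, heq j hj, hwz j hj]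
        · by_cases hkT : k ∈ S ∪ E w
          · have h1 := mul_nonneg he0.le (sub_nonneg.2 (hge k hkT))
            have h2 := hwt k hk
            simp only [v]; linarith
          · exact (he k hkT).le
      refine absurd (hwmin v hvH) (not_le.2 (Finset.card_lt_card ⟨?_, fun h => ?_⟩))
      · intro k hk
        simp only [E, Finset.mem_filter, Finset.mem_compl] at hk
        by_contra hkE
        have : k ∉ S ∪ E w := by rw [Finset.mem_union]; tauto
        have := he k this
        have h2 := hk.2
        simp only [v] at h2
        linarith
      · have h1 := h hiE
        simp only [E, Finset.mem_filter, v] at h1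
        have h2 := mul_pos he0 (sub_pos.2 hlt)
        linarith [h1.2]

/-- Max-min fair vectors exist in nonempty compact convex sets. -/
theorem maxMin_convex {n : ℕ} (F : Set (Fin n → ℝ)) (hF : IsCompact F) (hconv : Convex ℝ F)
    (hne : F.Nonempty) : ∃ z, MaxMinFair F z := by
  classical
  have key : ∀ k : ℕ, k ≤ n → ∃ (T : Finset (Fin n)) (w : Fin n → ℝ), k ≤ T.card ∧ w ∈ F ∧
      (∀ i ∈ T, ∀ k, k ∉ T → w i ≤ w k) ∧
      (∀ i ∈ T, ∀ z' ∈ F, w i < z' i → ∃ j ∈ T, w j ≤ w i ∧ z' j < w j) := by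
    intro k
    induction k with
    | zero =>
      intro _
      obtain ⟨z, hz⟩ := hne
      exact ⟨∅, z, by simp, hz, by simp, by simp⟩
    | succ k ih =>
      intro hk
      obtain ⟨T, w, h1, h2, h3, h4⟩ := ih (by omega)
      by_cases hT : Tᶜ.Nonempty
      · obtain ⟨T', w', h1', h'⟩ := maxMin_step F hF hconv T w h2 h3 h4 hT
        exact ⟨T', w', by omega, h'⟩
      · have : T = Finset.univ := by simpa using hT
        refine ⟨T, w, ?_, h2, h3, h4⟩
        rw [this]; simpa using hk
  obtain ⟨T, w, h1, h2, _, h4⟩ := key n le_rfl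
  have hT : T = Finset.univ := by
    rw [← Finset.card_eq_iff_eq_univ, Fintype.card_fin]
    exact le_antisymm (by simpa using Finset.card_le_univ T) h1
  refine ⟨w, h2, fun z' hz' i hi => ?_⟩
  obtain ⟨j, _, hj⟩ := h4 i (by simp [hT]) z' hz' hi
  exact ⟨j, hj⟩

/-- Existence of a max-min fair allocation for the admission-rate polytope with
linear capacity constraints. -/
theorem maxMinFair_exists {m n : ℕ} (hm : 1 ≤ m) (hn : 1 ≤ n)
    (A : Matrix (Fin m) (Fin n) ℝ) (hA : ∀ j i, 0 ≤ A j i)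
    (c : Fin m → ℝ) (hc : ∀ j, 0 ≤ c j) :
    ∃ z : Fin n → ℝ,
      MaxMinFair {w : Fin n → ℝ |
        (∀ i, 0 ≤ w i ∧ w i ≤ 1) ∧ ∀ j, A.mulVec w j ≤ c j} z := by
  apply maxMin_convex
  · have hbox : IsCompact (Set.Icc (0 : Fin n → ℝ) 1) := isCompact_Icc
    have hcl : IsClosed {w : Fin n → ℝ | ∀ j, A.mulVec w j ≤ c j} := by
      simp only [Set.ofPred_forall]
      refine isClosed_iInter fun j => isClosed_le ?_ continuous_const
      simp only [Matrix.mulVec, dotProduct]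
      fun_prop
    convert hbox.inter_right hcl using 1
    ext w
    simp [Pi.le_def, forall_and]
  · intro x hx y hy a b ha hb hab
    refine ⟨fun i => ?_, fun j => ?_⟩
    · have h1 := hx.1 i
      have h2 := hy.1 i
      simp only [Pi.add_apply, Pi.smul_apply, smul_eq_mul]
      constructor
      · exact add_nonneg (mul_nonneg ha h1.1) (mul_nonneg hb h2.1)
      · nlinarith
    · have h1 := hx.2 j
      have h2 := hy.2 j
      simp only [Matrix.mulVec_add, Matrix.mulVec_smul, Pi.add_apply, Pi.smul_apply, smul_eq_mul]
      have h3 : c j = a * c j + b * c j := by rw [← add_mul, hab, one_mul]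
      rw [h3]
      exact add_le_add (mul_le_mul_of_nonneg_left h1 ha) (mul_le_mul_of_nonneg_left h2 hb)
  · refine ⟨0, fun i => by simp, fun j => by simpa using hc j⟩
end
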